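/- arXiv:0712.3026 — 3 statements merged into one kernel-verified Lean document; each statement's English description precedes it below -/
import Mathlib

section
/- Let k, n be integers with k ≥ 2 and n ≥ 2k−1, and let T be a positive-weighted tree with leaf set [n]. For leaves α, α′ ∈ [n], condition ∗^{α,α′} holds for the family of k-weights {D_{i_1,…,i_k}(T)} if and only if α and α′ are neighbours in T. -/
/-- A weighted tree whose leaves are labeled bijectively by `Fin n`. -/
structure WeightedTree (n : ℕ) where
  V : Type
  [fintypeV : Fintype V]
  [decEqV : DecidableEq V]
  G : SimpleGraph V
  [decAdj : DecidableRel G.Adj]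
  isTree : G.IsTree
  w : Sym2 V → ℝ
  leaf : Fin n → V
  leaf_inj : Function.Injective leaf
  leaf_iff : ∀ v : V, (∃ i, leaf i = v) ↔ G.degree v ≤ 1

attribute [instance] WeightedTree.fintypeV WeightedTree.decEqV WeightedTree.decAdj

namespace WeightedTree

variable {n : ℕ}

/-- The unique path between two vertices of a tree. -/
noncomputable def treePath (T : WeightedTree n) (u v : T.V) : T.G.Walk u v :=
  (T.isTree.existsUnique_path u v).choose

/-- The sum of the weights of the edges on the path from `u` to `v`. -/
noncomputable def pathWeight (T : WeightedTree n) (u v : T.V) : ℝ :=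
  ((T.treePath u v).edges.map T.w).sum

open Classical in
/-- The total weight of the minimal subtree spanning the leaves indexed by `S`:
the sum of the weights of the edges lying on a path between two leaves of `S`. -/
noncomputable def D (T : WeightedTree n) (S : Finset (Fin n)) : ℝ :=
  ∑ e ∈ T.G.edgeFinset.filter
      (fun e => ∃ i ∈ S, ∃ j ∈ S, e ∈ (T.treePath (T.leaf i) (T.leaf j)).edges),
    T.w e

/-- All edge weights are positive. -/
def PosWeights (T : WeightedTree n) : Prop := ∀ e ∈ T.G.edgeSet, 0 < T.w e

/-- Two leaves are neighbours (form a cherry) if the path between them contains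
exactly one vertex of degree at least 3. -/
def Neighbours (T : WeightedTree n) (a b : Fin n) : Prop :=
  ∃! z : T.V, z ∈ (T.treePath (T.leaf a) (T.leaf b)).support ∧ 3 ≤ T.G.degree z

end WeightedTree

open WeightedTree

namespace WeightedTree

variable {n : ℕ} (T : WeightedTree n)

theorem treePath_isPath (u v : T.V) : (T.treePath u v).IsPath :=
  (T.isTree.existsUnique_path u v).choose_spec.1

variable {T}

theorem eq_treePath {u v : T.V} {p : T.G.Walk u v} (hp : p.IsPath) : p = T.treePath u v :=
  (T.isTree.existsUnique_path u v).choose_spec.2 p hp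

theorem treePath_eq_append {u v x : T.V} (hx : x ∈ (T.treePath u v).support) :
    T.treePath u v = (T.treePath u x).append (T.treePath x v) := by
  have hp := T.treePath_isPath u v
  rw [← eq_treePath (hp.takeUntil hx), ← eq_treePath (hp.dropUntil hx)]
  exact ((T.treePath u v).take_spec hx).symm

theorem treePath_of_adj {u v : T.V} (h : T.G.Adj u v) : T.treePath u v = h.toWalk :=
  (eq_treePath (by simp [SimpleGraph.Walk.cons_isPath_iff, h.ne])).symm

variable (T) in
/-- The edge `e` separates `u` from `v`: it lies on the path between them. -/
def Separates (e : Sym2 T.V) (u v : T.V) : Prop := e ∈ (T.treePath u v).edges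

theorem Separates.mem_edgeSet {e : Sym2 T.V} {u v : T.V} (h : T.Separates e u v) :
    e ∈ T.G.edgeSet :=
  SimpleGraph.Walk.edges_subset_edgeSet _ h

theorem not_separates_self (e : Sym2 T.V) (u : T.V) : ¬ T.Separates e u u := by
  rw [Separates, ← eq_treePath SimpleGraph.Walk.IsPath.nil]
  simp

theorem separates_comm {e : Sym2 T.V} {u v : T.V} : T.Separates e u v ↔ T.Separates e v u := by
  rw [Separates, ← eq_treePath (T.treePath_isPath v u).reverse]
  simp [Separates]

theorem separates_or_of_separates {e : Sym2 T.V} {u w : T.V} (v : T.V) (h : T.Separates e u w) :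
    T.Separates e u v ∨ T.Separates e v w := by
  rw [Separates,
    ← eq_treePath ((T.treePath u v).append (T.treePath v w)).bypass_isPath] at h
  simpa [Separates] using SimpleGraph.Walk.edges_bypass_subset_edges _ h

theorem separates_iff_or_of_mem_support {e : Sym2 T.V} {u v x : T.V}
    (hx : x ∈ (T.treePath u v).support) :
    T.Separates e u v ↔ T.Separates e u x ∨ T.Separates e x v := by
  rw [Separates, treePath_eq_append hx]
  simp [Separates]

theorem separates_endpoint_iff {a b : T.V} (h : T.G.Adj a b) (x : T.V) :
    T.Separates s(a, b) x a ↔ ¬ T.Separates s(a, b) x b := by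
  by_cases hb : b ∈ (T.treePath x a).support
  · have hab : T.Separates s(a, b) b a := by
      simp [Separates, treePath_of_adj h.symm, Sym2.eq_swap]
    have hnd : (T.treePath x a).edges.Nodup := (T.treePath_isPath x a).isTrail.edges_nodup
    rw [treePath_eq_append hb, SimpleGraph.Walk.edges_append] at hnd
    have := List.disjoint_of_nodup_append hnd
    rw [separates_iff_or_of_mem_support hb]
    simpa [hab] using fun h : T.Separates s(a, b) x b => this h hab
  · have h1 := eq_treePath ((T.treePath_isPath x a).concat hb h)
    have h2 : T.Separates s(a, b) x b := by
      rw [Separates, ← h1]; simp [SimpleGraph.Walk.edges_concat]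
    simpa [h2] using fun h : T.Separates s(a, b) x a =>
      hb (SimpleGraph.Walk.snd_mem_support_of_mem_edges _ h)

theorem separates_iff (e : Sym2 T.V) (u v w : T.V) :
    T.Separates e u w ↔ ¬ (T.Separates e u v ↔ T.Separates e v w) := by
  by_cases he : e ∈ T.G.edgeSet
  · induction e with | _ a b
    have key (x y : T.V) : T.Separates s(a, b) x y ↔
        ¬ (T.Separates s(a, b) x a ↔ T.Separates s(a, b) y a) := by
      have hx := separates_endpoint_iff he x
      have hy := separates_endpoint_iff he y
      have h1 : T.Separates s(a, b) x y → _ := separates_or_of_separates a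
      have h2 : T.Separates s(a, b) x y → _ := separates_or_of_separates b
      have h3 : T.Separates s(a, b) x a → _ := separates_or_of_separates y
      have h4 : T.Separates s(a, b) y a → _ := separates_or_of_separates x
      rw [separates_comm (u := a)] at h1
      rw [separates_comm (u := b)] at h2
      rw [separates_comm (u := y) (v := x)] at h4
      by_cases hxa : T.Separates s(a, b) x a <;> by_cases hya : T.Separates s(a, b) y a <;>
        simp_all
    rw [key u w, key u v, key v w]
    tauto
  · have h (x y : T.V) : ¬ T.Separates e x y := fun h => he h.mem_edgeSet
    simp [h]

theorem Separates.snd_eq {p v x : T.V} (h : T.Separates s(p, v) p x) :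
    (T.treePath p x).snd = v := by
  have hadj : T.G.Adj p v := h.mem_edgeSet
  have hv : v ∈ (T.treePath p x).support := SimpleGraph.Walk.snd_mem_support_of_mem_edges _ h
  rw [treePath_eq_append hv, treePath_of_adj hadj]
  simp

theorem card_le_degree {p : T.V} (s : Finset T.V) (hp : p ∉ s)
    (h : ∀ x ∈ s, ∀ y ∈ s, x ≠ y → ∀ e, T.Separates e p x → ¬ T.Separates e p y) :
    s.card ≤ T.G.degree p := by
  have hnil (x : T.V) (hx : x ∈ s) : ¬ (T.treePath p x).Nil :=
    SimpleGraph.Walk.not_nil_of_ne (by rintro rfl; exact hp hx)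
  rw [← T.G.card_neighborFinset_eq_degree]
  refine Finset.card_le_card_of_injOn (fun x => (T.treePath p x).snd) (fun x hx => ?_)
    (fun x hx y hy hxy => ?_)
  · simpa using (T.treePath p x).adj_snd (hnil x hx)
  · by_contra hne
    refine h x hx y hy hne _ (SimpleGraph.Walk.mk_start_snd_mem_edges (hnil x hx)) ?_
    simp only at hxy
    rw [hxy]
    exact SimpleGraph.Walk.mk_start_snd_mem_edges (hnil y hy)

theorem exists_mem_support_forall_not_separates (a b c : T.V) :
    ∃ p ∈ (T.treePath a b).support, ∀ e, T.Separates e p c → ¬ T.Separates e a b := by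
  obtain ⟨p, hp, hmin⟩ := (T.treePath a b).support.toFinset.exists_min_image
    (fun x => (T.treePath x c).length) ⟨a, by simp⟩
  simp only [List.mem_toFinset] at hp hmin
  refine ⟨p, hp, fun e h1 h2 => ?_⟩
  have key (x : T.V) (h1 : x ∈ (T.treePath p c).support) (h2 : x ∈ (T.treePath a b).support) :
      p = x := by
    have := hmin x h2
    rw [treePath_eq_append h1, SimpleGraph.Walk.length_append] at this
    exact SimpleGraph.Walk.eq_of_length_eq_zero (p := T.treePath p x) (by omega)
  induction e with | _ x y
  have hx := key x (SimpleGraph.Walk.fst_mem_support_of_mem_edges _ h1)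
    (SimpleGraph.Walk.fst_mem_support_of_mem_edges _ h2)
  have hy := key y (SimpleGraph.Walk.snd_mem_support_of_mem_edges _ h1)
    (SimpleGraph.Walk.snd_mem_support_of_mem_edges _ h2)
  have hadj : T.G.Adj x y := h1.mem_edgeSet
  exact hadj.ne (hx.symm.trans hy)

theorem exists_three_le_degree {a b c : Fin n} (hab : a ≠ b) (hac : a ≠ c) (hbc : b ≠ c) :
    ∃ p ∈ (T.treePath (T.leaf a) (T.leaf b)).support, 3 ≤ T.G.degree p ∧
      ∀ e, T.Separates e p (T.leaf c) → ¬ T.Separates e (T.leaf a) (T.leaf b) := by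
  obtain ⟨p, hp, hpc⟩ := exists_mem_support_forall_not_separates (T.leaf a) (T.leaf b) (T.leaf c)
  refine ⟨p, hp, ?_, hpc⟩
  have hsep (i : Fin n) (hi : i ∈ ({a, b, c} : Finset (Fin n))) (j : Fin n)
      (hj : j ∈ ({a, b, c} : Finset (Fin n))) (hij : i ≠ j) (e : Sym2 T.V) :
      T.Separates e p (T.leaf i) → ¬ T.Separates e p (T.leaf j) := by
    have h1 := hpc e
    have h2 := separates_iff_or_of_mem_support (e := e) hp
    have h3 := separates_iff e (T.leaf a) p (T.leaf b)
    rw [separates_comm (v := p)] at h2 h3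
    simp only [Finset.mem_insert, Finset.mem_singleton] at hi hj
    rcases hi with rfl | rfl | rfl <;> rcases hj with rfl | rfl | rfl <;> tauto
  have hdeg (s : Finset (Fin n)) (hs : s ⊆ {a, b, c}) (hps : ∀ i ∈ s, T.leaf i ≠ p) :
      s.card ≤ T.G.degree p := by
    rw [← Finset.card_map ⟨T.leaf, T.leaf_inj⟩]
    refine card_le_degree _ (by simpa using hps) ?_
    simp only [Finset.mem_map, Function.Embedding.coeFn_mk]
    rintro _ ⟨i, hi, rfl⟩ _ ⟨j, hj, rfl⟩ hij
    exact hsep i (hs hi) j (hs hj) (fun h => hij (by rw [h]))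
  have hcard : ({a, b, c} : Finset (Fin n)).card = 3 :=
    Finset.card_eq_three.2 ⟨a, b, c, hab, hac, hbc, rfl⟩
  have hne (i : Fin n) (hi : i ∈ ({a, b, c} : Finset (Fin n))) : T.leaf i ≠ p := by
    rintro rfl
    have h1 := hdeg (({a, b, c} : Finset (Fin n)).erase i) (Finset.erase_subset _ _)
      (fun j hj h => (Finset.mem_erase.1 hj).1 (T.leaf_inj h))
    rw [Finset.card_erase_of_mem hi, hcard] at h1
    have := (T.leaf_iff (T.leaf i)).1 ⟨i, rfl⟩
    omega
  exact hcard ▸ hdeg _ subset_rfl hne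

theorem exists_leaf_separates {p v : T.V} (h : T.G.Adj p v) :
    ∃ i, T.Separates s(p, v) p (T.leaf i) := by
  classical
  obtain ⟨x, hx, hmax⟩ := (Finset.univ.filter fun x => T.Separates s(p, v) p x).exists_max_image
    (fun x => (T.treePath p x).length)
    ⟨v, by rw [Finset.mem_filter_univ, Separates, treePath_of_adj h]; simp⟩
  simp only [Finset.mem_filter, Finset.mem_univ, true_and] at hx hmax
  suffices hd : T.G.degree x ≤ 1 by
    obtain ⟨i, rfl⟩ := (T.leaf_iff x).2 hd
    exact ⟨i, hx⟩
  rw [← T.G.card_neighborFinset_eq_degree, ← Finset.card_singleton (T.treePath p x).penultimate]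
  refine Finset.card_le_card fun y hy => ?_
  have hxy : T.G.Adj x y := by simpa using hy
  rw [Finset.mem_singleton]
  by_cases hys : y ∈ (T.treePath p x).support
  · rw [treePath_eq_append hys, treePath_of_adj hxy.symm]
    exact (SimpleGraph.Walk.penultimate_concat (T.treePath p y) hxy.symm).symm
  · exfalso
    have hc := eq_treePath ((T.treePath_isPath p x).concat hys hxy)
    have := hmax y (by
      rw [Separates, ← hc, SimpleGraph.Walk.edges_concat]
      simp only [List.concat_eq_append, List.mem_append]
      exact Or.inl hx)
    rw [← hc, SimpleGraph.Walk.length_concat] at this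
    omega

theorem not_separates_of_snd_ne {p x y : T.V} (hp : p ≠ x)
    (h : (T.treePath p x).snd ≠ (T.treePath p y).snd) {e : Sym2 T.V}
    (hx : T.Separates e p x) : ¬ T.Separates e p y := by
  intro hy
  have h1 : T.Separates s(p, (T.treePath p x).snd) p x :=
    SimpleGraph.Walk.mk_start_snd_mem_edges (SimpleGraph.Walk.not_nil_of_ne hp)
  have h2 : ¬ T.Separates s(p, (T.treePath p x).snd) p y := fun h2 => h h2.snd_eq.symm
  have h3 : T.Separates s(p, (T.treePath p x).snd) x y := by
    rw [separates_iff _ x p y, separates_comm (u := x)]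
    tauto
  have h4 := (separates_iff_or_of_mem_support (e := e)
    (SimpleGraph.Walk.fst_mem_support_of_mem_edges _ h3)).2 (Or.inl (separates_comm.1 hx))
  rw [separates_iff e x p y, separates_comm (u := x)] at h4
  tauto

theorem exists_leaf_same_side {p : T.V} (hp : 3 ≤ T.G.degree p) {a b : Fin n} {e : Sym2 T.V}
    (he : T.Separates e (T.leaf a) (T.leaf b)) :
    ∃ c, c ≠ a ∧ c ≠ b ∧ ¬ T.Separates e p (T.leaf c) := by
  have : Nonempty (Fin n) := ⟨a⟩
  choose! l hl using fun (v : T.V) (hv : T.G.Adj p v) => exists_leaf_separates hv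
  have hpl (v : T.V) (hv : T.G.Adj p v) : p ≠ T.leaf (l v) := by
    intro h
    have := hl v hv
    rw [← h] at this
    exact not_separates_self _ _ this
  rw [← T.G.card_neighborFinset_eq_degree] at hp
  obtain ⟨u, hu, v, hv, w, hw, huv, huw, hvw⟩ := Finset.two_lt_card.1 hp
  rw [SimpleGraph.mem_neighborFinset] at hu hv hw
  have key (x y : T.V) (hx : T.G.Adj p x) (hy : T.G.Adj p y) (hxy : x ≠ y) :
      ¬ (T.Separates e p (T.leaf (l x)) ∧ T.Separates e p (T.leaf (l y))) ∧ l x ≠ l y := by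
    have hne : (T.treePath p (T.leaf (l x))).snd ≠ (T.treePath p (T.leaf (l y))).snd := by
      rwa [(hl x hx).snd_eq, (hl y hy).snd_eq]
    exact ⟨fun h => not_separates_of_snd_ne (hpl x hx) hne h.1 h.2, fun h => hne (by rw [h])⟩
  have hpair (i j : Fin n) (hij : i ≠ j) (hi : ¬ T.Separates e p (T.leaf i))
      (hj : ¬ T.Separates e p (T.leaf j)) : ∃ c, c ≠ a ∧ c ≠ b ∧ ¬ T.Separates e p (T.leaf c) := by
    by_contra! hcon
    have h1 := separates_iff e (T.leaf i) p (T.leaf j)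
    rw [separates_comm (v := p)] at h1
    have h2 := separates_comm (e := e) (u := T.leaf a) (v := T.leaf b)
    have hi' : i = a ∨ i = b := by by_contra! h; exact hi (hcon i h.1 h.2)
    have hj' : j = a ∨ j = b := by by_contra! h; exact hj (hcon j h.1 h.2)
    rcases hi' with rfl | rfl <;> rcases hj' with rfl | rfl <;> tauto
  have h1 := key u v hu hv huv
  have h2 := key u w hu hw huw
  have h3 := key v w hv hw hvw
  by_cases su : T.Separates e p (T.leaf (l u))
  · exact hpair (l v) (l w) h3.2 (fun h => h1.1 ⟨su, h⟩) (fun h => h2.1 ⟨su, h⟩)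
  · by_cases sv : T.Separates e p (T.leaf (l v))
    · exact hpair (l u) (l w) h2.2 su (fun h => h3.1 ⟨sv, h⟩)
    · exact hpair (l u) (l v) h1.2 su sv

theorem neighbours_iff {a b c : Fin n} (hab : a ≠ b) (hca : c ≠ a) (hcb : c ≠ b) :
    T.Neighbours a b ↔ ∀ e, T.Separates e (T.leaf a) (T.leaf b) → ∀ i j, i ≠ a → i ≠ b →
      j ≠ a → j ≠ b → ¬ T.Separates e (T.leaf i) (T.leaf j) := by
  constructor
  · rintro ⟨z, -, hz⟩ e he i j hia hib hja hjb hij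
    obtain ⟨p, hp, hp3, hpi⟩ := exists_three_le_degree (T := T) hab hia.symm hib.symm
    obtain ⟨q, hq, hq3, hqj⟩ := exists_three_le_degree (T := T) hab hja.symm hjb.symm
    obtain rfl : p = q := (hz p ⟨hp, hp3⟩).trans (hz q ⟨hq, hq3⟩).symm
    rw [separates_iff e _ p, separates_comm (v := p)] at hij
    have := hpi e
    have := hqj e
    tauto
  · intro h
    obtain ⟨p, hp, hp3, -⟩ := exists_three_le_degree (T := T) hab hca.symm hcb.symm
    refine ⟨p, ⟨hp, hp3⟩, ?_⟩
    rintro q ⟨hq, hq3⟩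
    by_contra hne
    have he : T.Separates s(q, (T.treePath q p).snd) q p :=
      SimpleGraph.Walk.mk_start_snd_mem_edges (SimpleGraph.Walk.not_nil_of_ne hne)
    generalize s(q, (T.treePath q p).snd) = e at he
    have heab : T.Separates e (T.leaf a) (T.leaf b) := by
      have h1 := (separates_iff e q (T.leaf a) p).1 he
      rw [separates_comm (u := q) (v := T.leaf a)] at h1
      have h2 := separates_iff_or_of_mem_support (e := e) hp
      have h3 := separates_iff_or_of_mem_support (e := e) hq
      tauto
    obtain ⟨i, hia, hib, hi⟩ := exists_leaf_same_side hp3 heab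
    obtain ⟨j, hja, hjb, hj⟩ := exists_leaf_same_side hq3 heab
    refine h e heab i j hia hib hja hjb ?_
    rw [separates_iff e _ p, separates_iff e p q, separates_comm (v := p),
      separates_comm (u := p) (v := q)]
    tauto

theorem D_insert (a : Fin n) (Γ : Finset (Fin n)) [DecidablePred fun e => ∃ i ∈ Γ,
    T.Separates e (T.leaf a) (T.leaf i)] :
    T.D (insert a Γ) =
      ∑ e ∈ T.G.edgeFinset, if ∃ i ∈ Γ, T.Separates e (T.leaf a) (T.leaf i) then T.w e else 0 := by
  rw [D, Finset.sum_filter]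
  refine Finset.sum_congr rfl fun e _ => ?_
  congr 1
  refine propext ⟨?_, ?_⟩
  · rintro ⟨i, hi, j, hj, hij⟩
    rw [Finset.mem_insert] at hi hj
    rcases separates_or_of_separates (T.leaf a) hij with h | h
    · rcases hi with rfl | hi
      · exact absurd h (not_separates_self _ _)
      · exact ⟨i, hi, separates_comm.1 h⟩
    · rcases hj with rfl | hj
      · exact absurd h (not_separates_self _ _)
      · exact ⟨j, hj, h⟩
  · rintro ⟨i, hi, h⟩
    exact ⟨a, Finset.mem_insert_self _ _, i, Finset.mem_insert_of_mem hi, h⟩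

open Classical in
theorem D_insert_sub_D_insert (a b : Fin n) (Γ : Finset (Fin n)) :
    T.D (insert a Γ) - T.D (insert b Γ) =
      ∑ e ∈ T.G.edgeFinset.filter (fun e => T.Separates e (T.leaf a) (T.leaf b)),
        ((if ∃ i ∈ Γ, T.Separates e (T.leaf a) (T.leaf i) then T.w e else 0) -
          if ∃ i ∈ Γ, ¬ T.Separates e (T.leaf a) (T.leaf i) then T.w e else 0) := by
  rw [D_insert, D_insert, ← Finset.sum_sub_distrib, Finset.sum_filter]
  refine Finset.sum_congr rfl fun e _ => ?_
  have h (i : Fin n) := separates_iff e (T.leaf b) (T.leaf a) (T.leaf i)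
  rw [separates_comm (u := T.leaf b)] at h
  by_cases hab : T.Separates e (T.leaf a) (T.leaf b)
  · simp [h, hab]
  · have h' (i : Fin n) : T.Separates e (T.leaf b) (T.leaf i) ↔
        T.Separates e (T.leaf a) (T.leaf i) := by have := h i; tauto
    simp [h', hab]

theorem separates_of_card_le {a b i j : T.V} [DecidablePred fun e => T.Separates e a b]
    [DecidablePred fun e => T.Separates e a i] [DecidablePred fun e => T.Separates e a j]
    (hij : ((T.G.edgeFinset.filter fun e => T.Separates e a b).filter
        fun e => T.Separates e a i).card ≤
      ((T.G.edgeFinset.filter fun e => T.Separates e a b).filter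
        fun e => T.Separates e a j).card)
    {e : Sym2 T.V} (he : T.Separates e a b) (hi : T.Separates e a i) : T.Separates e a j := by
  by_contra hj
  obtain ⟨f, hfj, hfi⟩ : ∃ f ∈ (T.G.edgeFinset.filter fun e => T.Separates e a b).filter
      fun e => T.Separates e a j, f ∉ (T.G.edgeFinset.filter fun e => T.Separates e a b).filter
        fun e => T.Separates e a i := by
    by_contra! hsub
    have := Finset.eq_of_subset_of_card_le hsub hij
    have hmem : e ∈ (T.G.edgeFinset.filter fun e => T.Separates e a b).filter
        fun e => T.Separates e a i := by simp [he, hi, he.mem_edgeSet]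
    rw [← this] at hmem
    exact hj (Finset.mem_filter.1 hmem).2
  simp only [Finset.mem_filter, SimpleGraph.mem_edgeFinset] at hfj hfi
  obtain ⟨⟨hf, hfb⟩, hfj⟩ := hfj
  replace hfi : ¬ T.Separates f a i := fun h => hfi ⟨⟨hf, hfb⟩, h⟩
  have hfbi : T.Separates f b i := by
    rw [separates_iff f b a i, separates_comm (u := b)]
    tauto
  have hebi : ¬ T.Separates e b i := by
    rw [separates_iff e b a i, separates_comm (u := b)]
    tauto
  induction f with | _ x y
  have h1 := separates_iff_or_of_mem_support (e := e)
    (SimpleGraph.Walk.fst_mem_support_of_mem_edges _ hfj)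
  have h2 := separates_iff_or_of_mem_support (e := e)
    (SimpleGraph.Walk.fst_mem_support_of_mem_edges _ hfbi)
  have h3 := (separates_iff e a x b).1 he
  rw [separates_comm (u := x)] at h3
  tauto

end WeightedTree

theorem Finset.exists_subset_card_eq_forall_le {ι : Type*} [DecidableEq ι] (r : ι → ℕ)
    (s : Finset ι) {m : ℕ} (hm : m ≤ s.card) :
    ∃ t ⊆ s, t.card = m ∧ ∀ x ∈ t, ∀ y ∈ s \ t, r x ≤ r y := by
  induction m with
  | zero => exact ⟨∅, by simp⟩
  | succ m ih =>
    obtain ⟨t, hts, htm, ht⟩ := ih (by omega)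
    obtain ⟨z, hz, hmin⟩ := (s \ t).exists_min_image r
      (by rw [← Finset.card_pos, Finset.card_sdiff_of_subset hts]; omega)
    rw [Finset.mem_sdiff] at hz
    refine ⟨insert z t, Finset.insert_subset hz.1 hts, by simp [hz.2, htm], ?_⟩
    intro x hx y hy
    have hy' : y ∈ s \ t := Finset.sdiff_subset_sdiff subset_rfl (Finset.subset_insert _ _) hy
    rcases Finset.mem_insert.1 hx with rfl | hx
    · exact hmin y hy'
    · exact ht x hx y hy'

theorem Finset.exists_low_high_subsets {ι : Type*} [DecidableEq ι] (r : ι → ℕ)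
    (s : Finset ι) {m : ℕ} (hm : 1 ≤ m) (hs : 2 * m - 1 ≤ s.card) :
    ∃ t ⊆ s, ∃ u ⊆ s, t.card = m ∧ u.card = m ∧ (∀ x ∈ t, ∀ y ∈ u, r x ≤ r y) ∧
      (∀ z ∈ s, ∃ x ∈ t, r x ≤ r z) ∧ ∀ z ∈ s, ∃ y ∈ u, r z ≤ r y := by
  obtain ⟨t, hts, htm, ht⟩ := s.exists_subset_card_eq_forall_le r (m := m) (by omega)
  obtain ⟨p, hp, hmax⟩ := t.exists_max_image r (Finset.card_pos.1 (by omega))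
  have hle (x) (hx : x ∈ t) (y) (hy : y ∈ insert p (s \ t)) : r x ≤ r y := by
    rcases Finset.mem_insert.1 hy with rfl | hy
    · exact hmax x hx
    · exact ht x hx y hy
  obtain ⟨q, hq, hqmax⟩ := (insert p (s \ t)).exists_max_image r (Finset.insert_nonempty _ _)
  have hcard : m ≤ (insert p (s \ t)).card := by
    rw [Finset.card_insert_of_notMem (by simp [hp]), Finset.card_sdiff_of_subset hts]
    omega
  obtain ⟨u, hqu, hu, hum⟩ := Finset.exists_subsuperset_card_eq
    (Finset.singleton_subset_iff.2 hq) (by simpa using hm) hcard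
  refine ⟨t, hts, u, hu.trans (Finset.insert_subset (hts hp) Finset.sdiff_subset), htm, hum,
    fun x hx y hy => hle x hx y (hu hy), fun z hz => ?_,
    fun z hz => ⟨q, hqu (Finset.mem_singleton_self q), ?_⟩⟩
  · by_cases hzt : z ∈ t
    · exact ⟨z, hzt, le_rfl⟩
    · exact ⟨p, hp, ht p hp z (Finset.mem_sdiff.2 ⟨hz, hzt⟩)⟩
  · by_cases hzt : z ∈ t
    · exact hle z hzt q hq
    · exact hqmax z (Finset.mem_insert_of_mem (Finset.mem_sdiff.2 ⟨hz, hzt⟩))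

namespace WeightedTree

variable {n : ℕ} {T : WeightedTree n}

theorem D_insert_sub_D_insert_eq {a b : Fin n} {Γ Δ : Finset (Fin n)}
    (hΓ : Γ.Nonempty) (hΔ : Δ.Nonempty) (haΓ : a ∉ Γ) (hbΓ : b ∉ Γ) (haΔ : a ∉ Δ) (hbΔ : b ∉ Δ)
    (h : ∀ e, T.Separates e (T.leaf a) (T.leaf b) → ∀ i j, i ≠ a → i ≠ b →
      j ≠ a → j ≠ b → ¬ T.Separates e (T.leaf i) (T.leaf j)) :
    T.D (insert a Γ) - T.D (insert b Γ) = T.D (insert a Δ) - T.D (insert b Δ) := by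
  classical
  obtain ⟨z, hz⟩ := hΓ
  obtain ⟨y, hy⟩ := hΔ
  rw [D_insert_sub_D_insert, D_insert_sub_D_insert]
  refine Finset.sum_congr rfl fun e he => ?_
  have hside (i : Fin n) (hia : i ≠ a) (hib : i ≠ b) :
      T.Separates e (T.leaf a) (T.leaf i) ↔ T.Separates e (T.leaf a) (T.leaf z) := by
    have h1 := h e (Finset.mem_filter.1 he).2 i z hia hib (ne_of_mem_of_not_mem hz haΓ)
      (ne_of_mem_of_not_mem hz hbΓ)
    rw [separates_iff e _ (T.leaf a), separates_comm (v := T.leaf a)] at h1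
    tauto
  have hex (Λ : Finset (Fin n)) (ha : a ∉ Λ) (hb : b ∉ Λ) (hΛ : Λ.Nonempty) :
      ((∃ i ∈ Λ, T.Separates e (T.leaf a) (T.leaf i)) ↔ T.Separates e (T.leaf a) (T.leaf z)) ∧
      ((∃ i ∈ Λ, ¬ T.Separates e (T.leaf a) (T.leaf i)) ↔
        ¬ T.Separates e (T.leaf a) (T.leaf z)) := by
    have hi (i) (hi : i ∈ Λ) :=
      hside i (ne_of_mem_of_not_mem hi ha) (ne_of_mem_of_not_mem hi hb)
    obtain ⟨x, hx⟩ := hΛ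
    exact ⟨⟨fun ⟨i, h1, h2⟩ => (hi i h1).1 h2, fun h => ⟨x, hx, (hi x hx).2 h⟩⟩,
      ⟨fun ⟨i, h1, h2⟩ h => h2 ((hi i h1).2 h), fun h => ⟨x, hx, fun h2 => h ((hi x hx).1 h2)⟩⟩⟩
  simp only [hex Γ haΓ hbΓ ⟨z, hz⟩, hex Δ haΔ hbΔ ⟨y, hy⟩]

theorem exists_D_insert_sub_D_insert_lt (hpos : T.PosWeights) {m : ℕ} (hm : 1 ≤ m)
    (hn : 2 * m + 1 ≤ n) {a b i j : Fin n} (hab : a ≠ b) {e : Sym2 T.V}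
    (he : T.Separates e (T.leaf a) (T.leaf b)) (hia : i ≠ a) (hib : i ≠ b) (hja : j ≠ a)
    (hjb : j ≠ b) (hi : ¬ T.Separates e (T.leaf a) (T.leaf i))
    (hj : T.Separates e (T.leaf a) (T.leaf j)) :
    ∃ Γ Δ : Finset (Fin n), Γ.card = m ∧ Δ.card = m ∧ a ∉ Γ ∧ b ∉ Γ ∧ a ∉ Δ ∧ b ∉ Δ ∧
      T.D (insert a Γ) - T.D (insert b Γ) < T.D (insert a Δ) - T.D (insert b Δ) := by
  classical
  obtain ⟨Γ, hΓ, Δ, hΔ, hΓm, hΔm, hle, hlow, hhigh⟩ :=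
    ({a, b}ᶜ : Finset (Fin n)).exists_low_high_subsets
      (fun i => ((T.G.edgeFinset.filter fun e => T.Separates e (T.leaf a) (T.leaf b)).filter
        fun e => T.Separates e (T.leaf a) (T.leaf i)).card) hm
      (by rw [Finset.card_compl, Finset.card_pair hab, Fintype.card_fin]; omega)
  have hmono (f : Sym2 T.V) (hf : T.Separates f (T.leaf a) (T.leaf b)) (x) (hx : x ∈ Γ)
      (y) (hy : y ∈ Δ) (h : T.Separates f (T.leaf a) (T.leaf x)) :
      T.Separates f (T.leaf a) (T.leaf y) :=
    separates_of_card_le (hle x hx y hy) hf h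
  obtain ⟨x, hx, hxi⟩ := hlow i (by simp [hia, hib])
  obtain ⟨y, hy, hjy⟩ := hhigh j (by simp [hja, hjb])
  refine ⟨Γ, Δ, hΓm, hΔm, fun h => by simpa using hΓ h, fun h => by simpa using hΓ h,
    fun h => by simpa using hΔ h, fun h => by simpa using hΔ h, ?_⟩
  rw [D_insert_sub_D_insert, D_insert_sub_D_insert]
  refine Finset.sum_lt_sum (fun f hf => ?_)
    ⟨e, Finset.mem_filter.2 ⟨SimpleGraph.mem_edgeFinset.2 he.mem_edgeSet, he⟩, ?_⟩
  · rw [Finset.mem_filter, SimpleGraph.mem_edgeFinset] at hf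
    have hw := hpos f hf.1
    have h1 : (∃ i ∈ Γ, T.Separates f (T.leaf a) (T.leaf i)) →
        ∃ i ∈ Δ, T.Separates f (T.leaf a) (T.leaf i) :=
      fun ⟨z, hz, h⟩ => ⟨y, hy, hmono f hf.2 z hz y hy h⟩
    have h2 : (∃ i ∈ Δ, ¬ T.Separates f (T.leaf a) (T.leaf i)) →
        ∃ i ∈ Γ, ¬ T.Separates f (T.leaf a) (T.leaf i) :=
      fun ⟨z, hz, h⟩ => ⟨x, hx, fun h' => h (hmono f hf.2 x hx z hz h')⟩
    have hite (p q : Prop) [Decidable p] [Decidable q] (hpq : p → q) :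
        (if p then T.w f else 0) ≤ if q then T.w f else 0 := by
      by_cases hp : p
      · simp [hp, hpq hp]
      · rw [if_neg hp]
        split_ifs
        exacts [hw.le, le_rfl]
    exact sub_le_sub (hite _ _ h1) (hite _ _ h2)
  · have hw := hpos e he.mem_edgeSet
    have hx' : ∃ i ∈ Γ, ¬ T.Separates e (T.leaf a) (T.leaf i) :=
      ⟨x, hx, fun h => hi (separates_of_card_le hxi he h)⟩
    have hy' : ∃ i ∈ Δ, T.Separates e (T.leaf a) (T.leaf i) :=
      ⟨y, hy, separates_of_card_le hjy he hj⟩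
    have hnot : (∃ i ∈ Γ, T.Separates e (T.leaf a) (T.leaf i)) →
        ¬ ∃ i ∈ Δ, ¬ T.Separates e (T.leaf a) (T.leaf i) :=
      fun ⟨u, hu, h⟩ ⟨v, hv, h'⟩ => h' (hmono e he u hu v hv h)
    rw [if_pos hx', if_pos hy']
    by_cases hΓe : ∃ i ∈ Γ, T.Separates e (T.leaf a) (T.leaf i)
    · rw [if_pos hΓe, if_neg (hnot hΓe)]
      linarith
    · rw [if_neg hΓe]
      split_ifs <;> linarith

end WeightedTree

/-- For a positive-weighted tree `T` with leaf set `[n]`, `k ≥ 2`,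
`n ≥ 2k-1`, the condition `∗^{α,α'}` holds for the family of `k`-weights of `T`
iff `α` and `α'` are neighbours. -/
theorem star_iff_neighbours (k n : ℕ) (hk : 2 ≤ k) (hn : 2 * k - 1 ≤ n)
    (T : WeightedTree n) (hpos : T.PosWeights) (α α' : Fin n) (hαα' : α ≠ α') :
    (∃ c : ℝ, ∀ Γ : Finset (Fin n), Γ.card = k - 1 → α ∉ Γ → α' ∉ Γ →
        T.D (insert α Γ) - T.D (insert α' Γ) = c) ↔
      T.Neighbours α α' := by
  obtain ⟨β, hβ⟩ : ({α, α'}ᶜ : Finset (Fin n)).Nonempty := by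
    rw [← Finset.card_pos, Finset.card_compl, Finset.card_pair hαα', Fintype.card_fin]
    omega
  simp only [Finset.mem_compl, Finset.mem_insert, Finset.mem_singleton, not_or] at hβ
  rw [neighbours_iff hαα' hβ.1 hβ.2]
  constructor
  · rintro ⟨c, hc⟩ e he i j hiα hiα' hjα hjα' hij
    have key (i j : Fin n) (hiα : i ≠ α) (hiα' : i ≠ α') (hjα : j ≠ α) (hjα' : j ≠ α')
        (hi : ¬ T.Separates e (T.leaf α) (T.leaf i)) (hj : T.Separates e (T.leaf α) (T.leaf j)) :
        False := by
      obtain ⟨Γ, Δ, hΓ, hΔ, h1, h2, h3, h4, hlt⟩ := exists_D_insert_sub_D_insert_lt hpos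
        (m := k - 1) (by omega) (by omega) hαα' he hiα hiα' hjα hjα' hi hj
      rw [hc Γ hΓ h1 h2, hc Δ hΔ h3 h4] at hlt
      exact lt_irrefl c hlt
    rw [separates_iff e _ (T.leaf α), separates_comm (v := T.leaf α)] at hij
    have h1 := key i j hiα hiα' hjα hjα'
    have h2 := key j i hjα hjα' hiα hiα'
    tauto
  · intro h
    have hne (Γ : Finset (Fin n)) (hΓ : Γ.card = k - 1) : Γ.Nonempty :=
      Finset.card_pos.1 (by omega)
    by_cases hex : ∃ Γ : Finset (Fin n), Γ.card = k - 1 ∧ α ∉ Γ ∧ α' ∉ Γ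
    · obtain ⟨Δ, hΔ, h1, h2⟩ := hex
      exact ⟨T.D (insert α Δ) - T.D (insert α' Δ), fun Γ hΓ h3 h4 =>
        D_insert_sub_D_insert_eq (hne Γ hΓ) (hne Δ hΔ) h3 h4 h1 h2 h⟩
    · exact ⟨0, fun Γ hΓ h3 h4 => absurd ⟨Γ, hΓ, h3, h4⟩ hex⟩
end

section
/- Let T be a weighted tree with leaf set [n], n ≥ 5. Then for all distinct i, j ∈ [n] and all distinct r, s, u ∈ [n]∖{i,j}: D_{i,j}(T) = (2/3)(D_{i,j,r}(T)+D_{i,j,s}(T)+D_{i,j,u}(T)+D_{r,s,u}(T)) − (1/3)(D_{i,r,s}(T)+D_{i,r,u}(T)+D_{i,s,u}(T)+D_{j,r,s}(T)+D_{j,r,u}(T)+D_{j,s,u}(T)); in particular the right-hand side does not depend on the choice of r, s, u. -/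
open WeightedTree

namespace SimpleGraph

/-- Every vertex of a connected graph stays reachable from one of the two ends of an edge
after this edge is deleted. -/
lemma Walk.reachable_deleteEdges_or {V : Type*} {G : SimpleGraph V} {a b v : V}
    (p : G.Walk v a) :
    (G.deleteEdges {s(a, b)}).Reachable v a ∨ (G.deleteEdges {s(a, b)}).Reachable v b := by
  induction p with
  | nil => exact Or.inl (Reachable.refl _)
  | @cons v v' a h p ih =>
    by_cases he : s(v, v') = s(a, b)
    · rcases Sym2.eq_iff.1 he with ⟨rfl, -⟩ | ⟨rfl, -⟩
      · exact Or.inl (Reachable.refl _)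
      · exact Or.inr (Reachable.refl _)
    · have hadj : (G.deleteEdges {s(a, b)}).Adj v v' := by
        rw [deleteEdges_adj]
        exact ⟨h, by simpa using he⟩
      exact ih.imp hadj.reachable.trans hadj.reachable.trans

end SimpleGraph

namespace WeightedTree

variable {n : ℕ}

lemma isPath_treePath (T : WeightedTree n) (u v : T.V) : (T.treePath u v).IsPath :=
  (T.isTree.existsUnique_path u v).choose_spec.1

lemma mem_edges_treePath_iff (T : WeightedTree n) (e : Sym2 T.V) (u v : T.V) :
    e ∈ (T.treePath u v).edges ↔ ¬ (T.G.deleteEdges {e}).Reachable u v := by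
  refine ⟨fun he hr => ?_, fun hr => ?_⟩
  · obtain ⟨p, hp⟩ := hr.exists_isPath
    have hle := T.G.deleteEdges_le {e}
    have heq : p.mapLe hle = T.treePath u v :=
      (T.isTree.existsUnique_path u v).unique (hp.mapLe hle) (T.isPath_treePath u v)
    rw [← heq, SimpleGraph.Walk.edges_mapLe_eq_edges] at he
    have := p.edges_subset_edgeSet he
    simp at this
  · by_contra he
    exact hr ⟨(T.treePath u v).toDeleteEdge e he⟩

/-- Deleting an edge splits the vertices of a tree into two sides; the edge lies on a path
exactly if the ends of the path are on different sides. -/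
lemma exists_side (T : WeightedTree n) (e : Sym2 T.V) :
    ∃ side : T.V → Prop, ∀ u v, e ∈ (T.treePath u v).edges ↔ ¬ (side u ↔ side v) := by
  induction e with
  | _ a b =>
    refine ⟨fun v => (T.G.deleteEdges {s(a, b)}).Reachable v a, fun u v => ?_⟩
    rw [mem_edges_treePath_iff, not_iff_not]
    refine ⟨fun h => ⟨h.symm.trans, h.trans⟩, fun h => ?_⟩
    have side_or (x : T.V) := (T.treePath x a).reachable_deleteEdges_or (b := b)
    by_cases hu : (T.G.deleteEdges {s(a, b)}).Reachable u a
    · exact hu.trans (h.1 hu).symm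
    · exact ((side_or u).resolve_left hu).trans ((side_or v).resolve_left (mt h.2 hu)).symm

end WeightedTree

/-- in a weighted tree with leaf set `[n]`, `n ≥ 5`, the double
weight `D_{i,j}` is given by the stated combination of triple weights, for any
choice of distinct `r, s, u ∈ [n] ∖ {i,j}`; in particular the right-hand side
does not depend on this choice. -/
theorem double_weight_from_triple_weights (n : ℕ) (hn : 5 ≤ n)
    (T : WeightedTree n) (i j r s u : Fin n)
    (hij : i ≠ j) (hrs : r ≠ s) (hru : r ≠ u) (hsu : s ≠ u)
    (hri : r ≠ i) (hrj : r ≠ j) (hsi : s ≠ i) (hsj : s ≠ j)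
    (hui : u ≠ i) (huj : u ≠ j) :
    T.D {i, j} =
      2/3 * (T.D {i, j, r} + T.D {i, j, s} + T.D {i, j, u} + T.D {r, s, u}) -
        1/3 * (T.D {i, r, s} + T.D {i, r, u} + T.D {i, s, u} +
               T.D {j, r, s} + T.D {j, r, u} + T.D {j, s, u}) := by
  classical
  simp only [D, Finset.sum_filter, Finset.mul_sum, ← Finset.sum_add_distrib,
    ← Finset.sum_sub_distrib]
  refine Finset.sum_congr rfl fun e _ => ?_
  obtain ⟨side, hside⟩ := T.exists_side e
  simp only [hside, Finset.exists_mem_insert, Finset.mem_singleton, exists_eq_left]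
  by_cases hi : side (T.leaf i) <;> by_cases hj : side (T.leaf j) <;>
    by_cases hr : side (T.leaf r) <;> by_cases hs : side (T.leaf s) <;>
    by_cases hu : side (T.leaf u) <;> simp [hi, hj, hr, hs, hu] <;> ring
end

section
/- Every finite tree with no vertices of degree 2 and with at least 4 leaves contains four distinct leaves α, α′, β, β′ such that α and α′ are neighbours and β and β′ are neighbours (the two cherries may share the same stalk). -/
open SimpleGraph

variable {V : Type} [Fintype V] [DecidableEq V]

/-- The unique path between two vertices of a tree. -/
noncomputable def treePath (G : SimpleGraph V) (hG : G.IsTree) (u v : V) :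
    G.Walk u v :=
  (hG.existsUnique_path u v).choose

/-- Two leaves `a, b` of a tree are neighbours (they form a cherry) if the path
from `a` to `b` contains exactly one vertex of degree at least 3. -/
def Neighbours (G : SimpleGraph V) [DecidableRel G.Adj] (hG : G.IsTree)
    (a b : V) : Prop :=
  ∃! z : V, z ∈ (treePath G hG a b).support ∧ 3 ≤ G.degree z

namespace SimpleGraph.IsTree

/-- In a tree, a vertex has at most one neighbour closer to a given root. -/
theorem eq_of_adj_of_dist_lt {W : Type*} {G : SimpleGraph W} (hG : G.IsTree) {u v x y : W}
    (hx : G.Adj v x) (hy : G.Adj v y) (hxd : G.dist u x < G.dist u v)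
    (hyd : G.dist u y < G.dist u v) : x = y := by
  classical
  have key : ∀ z, G.Adj v z → G.dist u z < G.dist u v →
      ∃ p : G.Walk u v, p.IsPath ∧ p.penultimate = z := by
    intro z hz hzd
    obtain ⟨p, hp, hlen⟩ := (hG.connected u z).exists_path_of_dist
    refine ⟨p.concat hz.symm, hp.concat (fun hv => ?_) hz.symm, by simp⟩
    have h₁ := dist_le (p.takeUntil v hv)
    have h₂ := p.length_takeUntil_le_length hv
    omega
  obtain ⟨p, hp, rfl⟩ := key x hx hxd
  obtain ⟨q, hq, rfl⟩ := key y hy hyd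
  rw [(hG.existsUnique_path u v).unique hp hq]

/-- In a tree, a non-root vertex has a neighbour closer to the root. -/
theorem exists_adj_dist_lt {W : Type*} {G : SimpleGraph W} (hG : G.IsTree) {u v : W}
    (h : v ≠ u) :
    ∃ w, G.Adj v w ∧ G.dist u w < G.dist u v := by
  obtain ⟨p, -, hlen⟩ := (hG.connected v u).exists_path_of_dist
  cases p with
  | nil => exact absurd rfl h
  | cons hadj q =>
    refine ⟨_, hadj, ?_⟩
    have := dist_le q
    rw [dist_comm (u := u), dist_comm (u := u) (v := v), ← hlen, Walk.length_cons]
    omega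

/-- Vertices at maximal distance from a root of a tree have degree at most one. -/
theorem degree_le_one_of_forall_dist_le {G : SimpleGraph V} [DecidableRel G.Adj]
    (hG : G.IsTree) {u v : V} (hmax : ∀ x, G.dist u x ≤ G.dist u v) : G.degree v ≤ 1 := by
  rw [← card_neighborFinset_eq_degree, Finset.card_le_one]
  have key : ∀ z, G.Adj v z → G.dist u z < G.dist u v := fun z hz =>
    lt_of_le_of_ne (hmax z) (hG.dist_ne_of_adj u hz).symm
  intro x hx y hy
  rw [mem_neighborFinset] at hx hy
  exact hG.eq_of_adj_of_dist_lt hx hy (key x hx) (key y hy)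

/-- In a tree without vertices of degree two, two vertices at maximal distance from a given
root are adjacent to a common vertex of degree at least three. -/
theorem exists_cherry_of_root {G : SimpleGraph V} [DecidableRel G.Adj] (hG : G.IsTree)
    (hdeg : ∀ v : V, G.degree v ≠ 2) (hcard : 3 ≤ Fintype.card V) (u : V) :
    ∃ w a b : V, 3 ≤ G.degree w ∧ a ≠ b ∧ G.Adj w a ∧ G.Adj w b ∧
      (∀ x, G.dist u x ≤ G.dist u a) ∧ G.dist u b = G.dist u a := by
  obtain ⟨v, -, hv⟩ := Finset.exists_max_image Finset.univ (G.dist u) ⟨u, Finset.mem_univ u⟩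
  replace hv : ∀ x, G.dist u x ≤ G.dist u v := fun x => hv x (Finset.mem_univ x)
  have hvu : v ≠ u := by
    rintro rfl
    have : Fintype.card V ≤ 1 := Fintype.card_le_one_iff.2 fun x y => by
      have h (z : V) : v = z := by
        have := hv z
        rw [dist_self, Nat.le_zero] at this
        exact (hG.connected v z).dist_eq_zero_iff.1 this
      rw [← h x, ← h y]
    omega
  obtain ⟨w, hvw, hlt⟩ := hG.exists_adj_dist_lt hvu
  have hstep {x : V} (hx : G.Adj w x) (hxd : ¬ G.dist u x < G.dist u w) :
      G.dist u x = G.dist u v := by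
    have h₁ := hG.dist_eq_dist_add_one_of_adj u hx
    have h₂ := hG.dist_eq_dist_add_one_of_adj u hvw
    have := hv x
    omega
  have hw : 3 ≤ G.degree w := by
    by_contra! hlt3
    have hle : G.degree w ≤ 1 := by
      have := hdeg w
      omega
    have honly {x : V} (hx : G.Adj w x) : x = v := by
      rw [← card_neighborFinset_eq_degree, Finset.card_le_one] at hle
      exact hle x (by simpa using hx) v (by simpa using hvw.symm)
    have hwu : w = u := by
      by_contra hwu
      obtain ⟨x, hx, hxd⟩ := hG.exists_adj_dist_lt hwu
      obtain rfl := honly hx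
      omega
    subst hwu
    have hall : (Finset.univ : Finset V) ⊆ {w, v} := by
      intro x _
      by_contra hx
      simp only [Finset.mem_insert, Finset.mem_singleton, not_or] at hx
      have h₁ : G.dist w v = 1 := dist_eq_one_iff_adj.2 hvw.symm
      have h₂ := hv x
      have h₃ := (hG.connected w x).pos_dist_of_ne (Ne.symm hx.1)
      exact hx.2 (honly (dist_eq_one_iff_adj.1 (by omega)))
    have := (Finset.card_le_card hall).trans Finset.card_le_two
    rw [Finset.card_univ] at this
    omega
  have hcard' : 1 < ((G.neighborFinset w).erase v).card := by
    rw [Finset.card_erase_of_mem (by simpa using hvw.symm), card_neighborFinset_eq_degree]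
    omega
  obtain ⟨x, hx, y, hy, hxy⟩ := Finset.one_lt_card.1 hcard'
  simp only [Finset.mem_erase, mem_neighborFinset] at hx hy
  by_cases hxd : G.dist u x < G.dist u w
  · have hyd : ¬ G.dist u y < G.dist u w := fun hyd =>
      hxy (hG.eq_of_adj_of_dist_lt hx.2 hy.2 hxd hyd)
    exact ⟨w, v, y, hw, hy.1.symm, hvw.symm, hy.2, hv, hstep hy.2 hyd⟩
  · exact ⟨w, v, x, hw, hx.1.symm, hvw.symm, hx.2, hv, hstep hx.2 hxd⟩

end SimpleGraph.IsTree

/-- Two distinct leaves adjacent to a common vertex of degree at least three are neighbours. -/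
theorem Neighbours.of_adj {G : SimpleGraph V} [DecidableRel G.Adj] (hG : G.IsTree)
    {w a b : V} (hw : 3 ≤ G.degree w) (hab : a ≠ b) (ha : G.Adj w a) (hb : G.Adj w b)
    (hda : G.degree a ≤ 1) (hdb : G.degree b ≤ 1) : Neighbours G hG a b := by
  have hp : (Walk.cons ha.symm (Walk.cons hb Walk.nil)).IsPath := by
    simp [Walk.cons_isPath_iff, hab, ha.ne', hb.ne]
  have heq : treePath G hG a b = Walk.cons ha.symm (Walk.cons hb Walk.nil) :=
    (hG.existsUnique_path a b).unique (hG.existsUnique_path a b).choose_spec.1 hp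
  unfold Neighbours
  rw [heq]
  refine ⟨w, ⟨by simp, hw⟩, ?_⟩
  rintro z ⟨hz, hz3⟩
  simp only [Walk.support_cons, Walk.support_nil, List.mem_cons, List.not_mem_nil,
    or_false] at hz
  rcases hz with rfl | rfl | rfl
  · omega
  · rfl
  · omega

/-- every finite tree with no vertices of degree 2 and with at
least 4 leaves contains four distinct leaves `α, α', β, β'` such that `α, α'`
are neighbours and `β, β'` are neighbours. -/
theorem exists_two_cherries (G : SimpleGraph V) [DecidableRel G.Adj]
    (hG : G.IsTree) (hdeg : ∀ v : V, G.degree v ≠ 2)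
    (hleaves : 4 ≤ (Finset.univ.filter (fun v : V => G.degree v ≤ 1)).card) :
    ∃ α α' β β' : V,
      G.degree α ≤ 1 ∧ G.degree α' ≤ 1 ∧ G.degree β ≤ 1 ∧ G.degree β' ≤ 1 ∧
      α ≠ α' ∧ α ≠ β ∧ α ≠ β' ∧ α' ≠ β ∧ α' ≠ β' ∧ β ≠ β' ∧
      Neighbours G hG α α' ∧ Neighbours G hG β β' := by
  have hcard : 3 ≤ Fintype.card V := by
    have := hleaves.trans (Finset.card_le_univ _)
    omega
  obtain ⟨r⟩ := hG.connected.nonempty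
  obtain ⟨w, a, a', hw, haa', hwa, hwa', hmax, ha'⟩ := hG.exists_cherry_of_root hdeg hcard r
  have hda : G.degree a ≤ 1 := hG.degree_le_one_of_forall_dist_le hmax
  have hda' : G.degree a' ≤ 1 := hG.degree_le_one_of_forall_dist_le (ha' ▸ hmax)
  have hna : Neighbours G hG a a' := .of_adj hG hw haa' hwa hwa' hda hda'
  obtain ⟨s, b, b', hs, hbb', hsb, hsb', hmaxb, hb'⟩ := hG.exists_cherry_of_root hdeg hcard a
  have hdist : G.dist a a' ≤ 2 := dist_le (Walk.cons hwa.symm (Walk.cons hwa' Walk.nil))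
  by_cases hfar : 2 < G.dist a b
  · have hdb : G.degree b ≤ 1 := hG.degree_le_one_of_forall_dist_le hmaxb
    have hdb' : G.degree b' ≤ 1 := hG.degree_le_one_of_forall_dist_le (hb' ▸ hmaxb)
    have hne {x y : V} (hx : G.dist a x ≤ 2) (hy : G.dist a y = G.dist a b) : x ≠ y := by
      rintro rfl
      omega
    have haa : G.dist a a ≤ 2 := by simp
    exact ⟨a, a', b, b', hda, hda', hdb, hdb', haa', hne haa rfl, hne haa hb', hne hdist rfl,
      hne hdist hb', hbb', hna, .of_adj hG hs hbb' hsb hsb' hdb hdb'⟩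
  · have hstar {x : V} (hx : G.degree x ≤ 1) (hxa : x ≠ a) : G.Adj w x := by
      have hxw : x ≠ w := by
        rintro rfl
        omega
      have honly {y : V} (hy : G.Adj a y) : y = w := by
        rw [← card_neighborFinset_eq_degree, Finset.card_le_one] at hda
        exact hda y (by simpa using hy) w (by simpa using hwa.symm)
      obtain ⟨p, -, hp⟩ := (hG.connected a x).exists_path_of_dist
      have hle : p.length ≤ 2 := by
        have := hmaxb x
        omega
      match p, hle with
      | .nil, _ => exact absurd rfl hxa
      | .cons h .nil, _ => exact absurd (honly h) hxw
      | .cons h (.cons h' .nil), _ => exact honly h ▸ h'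
      | .cons _ (.cons _ (.cons _ q)), hle =>
        simp only [Walk.length_cons] at hle
        omega
    set L := Finset.univ.filter (fun v : V => G.degree v ≤ 1) with hL
    have hrest : 1 < ((L.erase a).erase a').card := by
      have h₁ := Finset.pred_card_le_card_erase (s := L) (a := a)
      have h₂ := Finset.pred_card_le_card_erase (s := L.erase a) (a := a')
      omega
    obtain ⟨x, hx, y, hy, hxy⟩ := Finset.one_lt_card.1 hrest
    simp only [hL, Finset.mem_erase, Finset.mem_filter, Finset.mem_univ, true_and] at hx hy
    obtain ⟨hxa', hxa, hdx⟩ := hx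
    obtain ⟨hya', hya, hdy⟩ := hy
    exact ⟨a, a', x, y, hda, hda', hdx, hdy, haa', hxa.symm, hya.symm, hxa'.symm, hya'.symm,
      hxy, hna, .of_adj hG hw hxy (hstar hdx hxa) (hstar hdy hya) hdx hdy⟩
end
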